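/- arXiv:1608.03174 — 3 statements merged into one kernel-verified Lean document; each statement's English description precedes it below -/
import Mathlib

section
/- For every positive integer n, the value of the Riemann zeta function at 2n+1 satisfies ζ(2n+1) = (-1)^{n+1} ∫_{(0,1)^n} (∏_{i=1}^{n} log(x_i)/x_i) · log(1 - ∏_{i=1}^{n} x_i) dx_1 ⋯ dx_n. -/
open MeasureTheory Real

/-- The Riemann zeta function at integer arguments `s ≥ 2`, as the convergent
series `∑_{k=1}^∞ 1/k^s`. -/
noncomputable def zetaVal (s : ℕ) : ℝ := ∑' k : ℕ, 1 / ((k : ℝ) + 1) ^ s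

theorem intervalIntegrable_pow_mul_log (k : ℕ) (a b : ℝ) :
    IntervalIntegrable (fun x : ℝ => x ^ k * Real.log x) volume a b :=
  intervalIntegral.intervalIntegrable_log'.continuousOn_mul (by fun_prop)

theorem integrableOn_Ioo_pow_mul_log (k : ℕ) :
    IntegrableOn (fun x : ℝ => x ^ k * Real.log x) (Set.Ioo 0 1) :=
  (intervalIntegrable_iff_integrableOn_Ioo_of_le zero_le_one).1
    (intervalIntegrable_pow_mul_log k 0 1)

theorem integral_Ioo_pow_mul_log (k : ℕ) :
    ∫ x in Set.Ioo (0 : ℝ) 1, x ^ k * Real.log x = -(1 / ((k : ℝ) + 1) ^ 2) := by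
  have hk : (k : ℝ) + 1 ≠ 0 := by positivity
  rw [← integral_Ioc_eq_integral_Ioo, ← intervalIntegral.integral_of_le zero_le_one]
  rw [intervalIntegral.integral_eq_sub_of_hasDerivAt_of_le zero_le_one
    (f := fun x => x ^ k * (x * Real.log x) / (k + 1) - x ^ (k + 1) / (k + 1) ^ 2)
    _ _ (intervalIntegrable_pow_mul_log k 0 1)]
  · simp
  · have := Real.continuous_mul_log
    exact Continuous.continuousOn (by fun_prop)
  · intro x hx
    have hx0 : x ≠ 0 := hx.1.ne'
    have h := (((hasDerivAt_pow (k + 1) x).mul (Real.hasDerivAt_log hx0)).div_const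
      ((k : ℝ) + 1)).sub ((hasDerivAt_pow (k + 1) x).div_const (((k : ℝ) + 1) ^ 2))
    convert h using 1
    · ext y
      simp [pow_succ, mul_assoc]
    · push_cast
      field_simp
      ring

theorem integral_Ioo_norm_pow_mul_log (k : ℕ) :
    ∫ x in Set.Ioo (0 : ℝ) 1, ‖x ^ k * Real.log x‖ = 1 / ((k : ℝ) + 1) ^ 2 := by
  rw [← neg_neg (1 / ((k : ℝ) + 1) ^ 2), ← integral_Ioo_pow_mul_log, ← integral_neg]
  refine setIntegral_congr_fun measurableSet_Ioo fun x hx => ?_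
  exact norm_of_nonpos (mul_nonpos_of_nonneg_of_nonpos (pow_nonneg hx.1.le k)
    (Real.log_nonpos hx.1.le hx.2.le))

theorem hasSum_prod_log_div_mul_log_one_sub {ι : Type*} [Fintype ι] [Nonempty ι] {x : ι → ℝ}
    (hx : ∀ i, x i ∈ Set.Ioo (0 : ℝ) 1) :
    HasSum (fun k : ℕ => -(1 / ((k : ℝ) + 1)) * ∏ i, (x i ^ k * Real.log (x i)))
      ((∏ i, Real.log (x i) / x i) * Real.log (1 - ∏ i, x i)) := by
  have hpos : 0 < ∏ i, x i := Finset.prod_pos fun i _ => (hx i).1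
  have hlt : ∏ i, x i < 1 := by
    simpa using Finset.prod_lt_prod_of_nonempty (fun i _ => (hx i).1) (fun i _ => (hx i).2)
      (Finset.univ_nonempty (α := ι))
  have h := (Real.hasSum_pow_div_log_of_abs_lt_one (abs_lt.2 ⟨by linarith, hlt⟩)).mul_left
    (-∏ i, Real.log (x i) / x i)
  rw [neg_mul_neg] at h
  refine h.congr_fun fun k => ?_
  rw [Finset.prod_mul_distrib, Finset.prod_div_distrib, Finset.prod_pow]
  field_simp
  ring

theorem summable_one_div_nat_add_one_pow {s : ℕ} (hs : 1 < s) :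
    Summable fun k : ℕ => 1 / ((k : ℝ) + 1) ^ s := by
  simpa using (summable_nat_add_iff 1).2 (Real.summable_one_div_nat_pow.2 hs)

theorem zeta_odd_integral (n : ℕ) (hn : 0 < n) :
    zetaVal (2 * n + 1) =
      (-1 : ℝ) ^ (n + 1) *
        ∫ x in Set.univ.pi (fun _ : Fin n => Set.Ioo (0 : ℝ) 1),
          (∏ i, Real.log (x i) / x i) * Real.log (1 - ∏ i, x i) := by
  have : Nonempty (Fin n) := ⟨⟨0, hn⟩⟩
  let μ : Measure (Fin n → ℝ) := Measure.pi fun _ => volume.restrict (Set.Ioo (0 : ℝ) 1)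
  have hμ : volume.restrict (Set.univ.pi fun _ : Fin n => Set.Ioo (0 : ℝ) 1) = μ :=
    Measure.restrict_pi_pi _ _
  let F : ℕ → (Fin n → ℝ) → ℝ :=
    fun k x => -(1 / ((k : ℝ) + 1)) * ∏ i, (x i ^ k * Real.log (x i))
  have hF (k : ℕ) : Integrable (F k) μ :=
    (Integrable.fintype_prod fun _ => integrableOn_Ioo_pow_mul_log k).const_mul _
  have hint (k : ℕ) : ∫ x, F k x ∂μ = (-1) ^ (n + 1) * (1 / ((k : ℝ) + 1) ^ (2 * n + 1)) := by
    simp only [F, μ]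
    rw [integral_const_mul, integral_fintype_prod_eq_prod (𝕜 := ℝ)
      (fun _ x => x ^ k * Real.log x)]
    simp only [integral_Ioo_pow_mul_log, Finset.prod_const, Finset.card_univ, Fintype.card_fin]
    rw [neg_pow, div_pow, ← pow_mul]
    field_simp
    ring
  have hnorm (k : ℕ) : ∫ x, ‖F k x‖ ∂μ = 1 / ((k : ℝ) + 1) ^ (2 * n + 1) := by
    simp only [F, μ, norm_mul (-(1 / ((k : ℝ) + 1))), norm_prod]
    rw [integral_const_mul, integral_fintype_prod_eq_prod (𝕜 := ℝ)
      (fun _ x => ‖x ^ k * Real.log x‖)]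
    simp only [integral_Ioo_norm_pow_mul_log, Finset.prod_const, Finset.card_univ,
      Fintype.card_fin]
    rw [norm_neg, Real.norm_of_nonneg (by positivity), div_pow, ← pow_mul]
    field_simp
    ring
  have hsum : Summable fun k => ∫ x, ‖F k x‖ ∂μ := by
    simpa only [hnorm] using summable_one_div_nat_add_one_pow (by omega : 1 < 2 * n + 1)
  have htsum : ∫ x in Set.univ.pi (fun _ : Fin n => Set.Ioo (0 : ℝ) 1),
      (∏ i, Real.log (x i) / x i) * Real.log (1 - ∏ i, x i) = ∫ x, ∑' k, F k x ∂μ := by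
    rw [← hμ]
    refine setIntegral_congr_fun (MeasurableSet.univ_pi fun _ => measurableSet_Ioo) fun x hx => ?_
    exact (hasSum_prod_log_div_mul_log_one_sub fun i => hx i (Set.mem_univ i)).tsum_eq.symm
  rw [htsum, ← integral_tsum_of_summable_integral_norm hF hsum]
  simp only [hint]
  rw [tsum_mul_left, ← mul_assoc, ← mul_pow, neg_one_mul, neg_neg, one_pow, one_mul, zetaVal]
end

section
/- (Janous's formula) ζ(3) = (1/2) ∫_0^1 log(x)·log(1-x)/(x(1-x)) dx. -/
open MeasureTheory Real

theorem integrableOn_log_mul_pow_Ioo (n : ℕ) :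
    IntegrableOn (fun x : ℝ => Real.log x * x ^ n) (Set.Ioo 0 1) := by
  rw [← intervalIntegrable_iff_integrableOn_Ioo_of_le zero_le_one]
  exact intervalIntegral.intervalIntegrable_log'.mul_continuousOn (by fun_prop)

theorem integral_log_mul_pow_Ioo (n : ℕ) :
    ∫ x in Set.Ioo (0 : ℝ) 1, Real.log x * x ^ n = -(1 / ((n : ℝ) + 1) ^ 2) := by
  have hn : (n : ℝ) + 1 ≠ 0 := by positivity
  rw [← integral_Ioc_eq_integral_Ioo, ← intervalIntegral.integral_of_le zero_le_one]
  rw [intervalIntegral.integral_eq_sub_of_hasDerivAt_of_le (a := 0) (b := 1) zero_le_one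
    (f := fun x : ℝ => x ^ n * (x * Real.log x) / (n + 1) - x ^ (n + 1) / (n + 1) ^ 2)]
  · simp
  · have := Real.continuous_mul_log
    fun_prop
  · intro x hx
    have hx0 : x ≠ 0 := hx.1.ne'
    have h₁ : HasDerivAt (fun x : ℝ => x ^ (n + 1)) ((n + 1) * x ^ n) x := by
      simpa using hasDerivAt_pow (n + 1) x
    have h₂ := ((h₁.mul (Real.hasDerivAt_log hx0)).div_const ((n : ℝ) + 1)).sub
      (h₁.div_const (((n : ℝ) + 1) ^ 2))
    convert! h₂ using 1
    · ext y
      simp [pow_succ, mul_assoc]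
    · field_simp
      ring
  · exact intervalIntegral.intervalIntegrable_log'.mul_continuousOn (by fun_prop)

theorem summable_one_div_natCast_add_one_cube :
    Summable fun k : ℕ => 1 / ((k : ℝ) + 1) ^ 3 := by
  simpa using (summable_nat_add_iff 1).2
    (Real.summable_one_div_nat_pow.2 (by norm_num : 1 < 3))

theorem zetaVal_three_pos : 0 < zetaVal 3 :=
  summable_one_div_natCast_add_one_cube.tsum_pos (fun k => by positivity) 0 (by simp)

theorem integral_log_mul_log_one_sub_div :
    ∫ x in Set.Ioo (0 : ℝ) 1, Real.log x * Real.log (1 - x) / x = zetaVal 3 := by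
  have hint (n : ℕ) : ∫ x in Set.Ioo (0 : ℝ) 1, -(Real.log x * x ^ n) / (n + 1) =
      1 / ((n : ℝ) + 1) ^ 3 := by
    rw [integral_div, integral_neg, integral_log_mul_pow_Ioo]
    field_simp
  have hnorm (n : ℕ) : ∫ x in Set.Ioo (0 : ℝ) 1, ‖-(Real.log x * x ^ n) / (n + 1)‖ =
      1 / ((n : ℝ) + 1) ^ 3 := by
    rw [← hint n]
    refine setIntegral_congr_fun measurableSet_Ioo fun x hx => Real.norm_of_nonneg ?_
    have h₁ := mul_nonneg (neg_nonneg.2 (Real.log_nonpos hx.1.le hx.2.le)) (pow_nonneg hx.1.le n)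
    rw [neg_mul] at h₁
    positivity
  have hsum := hasSum_integral_of_summable_integral_norm
    (μ := volume.restrict (Set.Ioo (0 : ℝ) 1))
    (F := fun (n : ℕ) (x : ℝ) => -(Real.log x * x ^ n) / (n + 1))
    (fun n => (integrableOn_log_mul_pow_Ioo n).neg.div_const _)
    (by simpa only [hnorm] using summable_one_div_natCast_add_one_cube)
  simp only [hint] at hsum
  rw [zetaVal, hsum.tsum_eq]
  refine setIntegral_congr_fun measurableSet_Ioo fun x hx => ?_
  have hx0 : x ≠ 0 := hx.1.ne'
  have hlog := (Real.hasSum_pow_div_log_of_abs_lt_one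
    (abs_lt.2 ⟨by linarith [hx.1], hx.2⟩)).mul_left (-Real.log x / x)
  have hterm : (fun n : ℕ => -(Real.log x * x ^ n) / ((n : ℝ) + 1)) =
      fun n : ℕ => -Real.log x / x * (x ^ (n + 1) / ((n : ℝ) + 1)) := by
    ext n
    field_simp
    ring
  simp only [hterm, hlog.tsum_eq]
  ring

theorem integrableOn_log_mul_log_one_sub_div :
    IntegrableOn (fun x : ℝ => Real.log x * Real.log (1 - x) / x) (Set.Ioo 0 1) := by
  refine Integrable.of_integral_ne_zero ?_
  rw [integral_log_mul_log_one_sub_div]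
  exact zetaVal_three_pos.ne'

theorem janous_formula :
    zetaVal 3 =
      (1 / 2) * ∫ x in Set.Ioo (0 : ℝ) 1,
        Real.log x * Real.log (1 - x) / (x * (1 - x)) := by
  let f : ℝ → ℝ := fun x => Real.log x * Real.log (1 - x) / x
  have hf : IntervalIntegrable f volume 0 1 :=
    (intervalIntegrable_iff_integrableOn_Ioo_of_le zero_le_one).2
      integrableOn_log_mul_log_one_sub_div
  have hf' : IntervalIntegrable (fun x => f (1 - x)) volume 0 1 := by
    simpa using (hf.comp_sub_left 1).symm
  have hval : ∫ x in (0 : ℝ)..1, f x = zetaVal 3 := by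
    rw [intervalIntegral.integral_of_le zero_le_one, integral_Ioc_eq_integral_Ioo]
    exact integral_log_mul_log_one_sub_div
  have hsplit : ∫ x in Set.Ioo (0 : ℝ) 1, Real.log x * Real.log (1 - x) / (x * (1 - x)) =
      ∫ x in Set.Ioo (0 : ℝ) 1, (f x + f (1 - x)) := by
    refine setIntegral_congr_fun measurableSet_Ioo fun x hx => ?_
    have hx0 : x ≠ 0 := hx.1.ne'
    have hx1 : 1 - x ≠ 0 := (sub_pos.2 hx.2).ne'
    simp only [f, sub_sub_cancel]
    field_simp
    ring
  rw [hsplit, ← integral_Ioc_eq_integral_Ioo, ← intervalIntegral.integral_of_le zero_le_one,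
    intervalIntegral.integral_add hf hf', intervalIntegral.integral_comp_sub_left,
    sub_self, sub_zero, hval]
  ring
end

section
/- For every integer k ≥ 1, ∫_{(0,1)^2} (log(x)/x)·(log(y)/y)·log(1-xy)·log(x)·log(y)·(xy)^{2k+1} dx dy = −4 ∑_{u=1}^{∞} 1/(u·(2k+1+u)^6). -/
open MeasureTheory Real

theorem integrableOn_pow_mul_log_sq (n : ℕ) :
    IntegrableOn (fun x : ℝ => x ^ (n + 2) * Real.log x ^ 2) (Set.Ioo 0 1) := by
  have h : (fun x : ℝ => x ^ (n + 2) * Real.log x ^ 2) =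
      fun x => x ^ n * (x * Real.log x) ^ 2 := by
    funext x
    ring
  rw [h]
  exact (((continuous_pow n).mul (Real.continuous_mul_log.pow 2)).integrableOn_Icc
    (a := 0) (b := 1)).mono_set Set.Ioo_subset_Icc_self

theorem integral_pow_mul_log_sq (n : ℕ) :
    ∫ x in Set.Ioo (0 : ℝ) 1, x ^ (n + 2) * Real.log x ^ 2 = 2 / ((n : ℝ) + 3) ^ 3 := by
  have hn : (n : ℝ) + 3 ≠ 0 := by positivity
  rw [← integral_Ioc_eq_integral_Ioo, ← intervalIntegral.integral_of_le zero_le_one]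
  rw [intervalIntegral.integral_eq_sub_of_hasDerivAt_of_le zero_le_one
    (f := fun x : ℝ => x ^ (n + 1) * (x * Real.log x) ^ 2 / ((n : ℝ) + 3) -
      2 * (x ^ (n + 2) * (x * Real.log x)) / ((n : ℝ) + 3) ^ 2 +
      2 * x ^ (n + 3) / ((n : ℝ) + 3) ^ 3)]
  · simp
  · have := Real.continuous_mul_log
    fun_prop
  · intro x hx
    have hx0 : x ≠ 0 := hx.1.ne'
    have hlog := (hasDerivAt_id x).mul (Real.hasDerivAt_log hx0)
    have h := ((((hasDerivAt_pow (n + 1) x).mul (hlog.pow 2)).div_const ((n : ℝ) + 3)).sub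
      ((((hasDerivAt_pow (n + 2) x).mul hlog).const_mul 2).div_const (((n : ℝ) + 3) ^ 2))).add
      (((hasDerivAt_pow (n + 3) x).const_mul 2).div_const (((n : ℝ) + 3) ^ 3))
    refine h.congr_deriv ?_
    simp
    field_simp
    ring
  · rw [intervalIntegrable_iff_integrableOn_Ioo_of_le zero_le_one]
    exact integrableOn_pow_mul_log_sq n

theorem double_integral_series_one (k : ℕ) (hk : 1 ≤ k) :
    (∫ p in (Set.Ioo (0 : ℝ) 1) ×ˢ (Set.Ioo (0 : ℝ) 1),
        (Real.log p.1 / p.1) * (Real.log p.2 / p.2) * Real.log (1 - p.1 * p.2) *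
          Real.log p.1 * Real.log p.2 * (p.1 * p.2) ^ (2 * k + 1)) =
      -4 * ∑' u : ℕ, 1 / (((u : ℝ) + 1) * (2 * (k : ℝ) + 1 + ((u : ℝ) + 1)) ^ 6) := by
  obtain ⟨m, rfl⟩ : ∃ m, k = m + 1 := ⟨k - 1, by omega⟩
  let g : ℕ → ℝ → ℝ := fun u x => x ^ (2 * m + u + 1 + 2) * Real.log x ^ 2
  let F : ℕ → ℝ × ℝ → ℝ := fun u p => -(1 / ((u : ℝ) + 1)) * (g u p.1 * g u p.2)
  have hF_int (u : ℕ) : Integrable (F u)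
      (volume.restrict (Set.Ioo (0 : ℝ) 1 ×ˢ Set.Ioo (0 : ℝ) 1)) := by
    rw [Measure.volume_eq_prod, ← Measure.prod_restrict]
    exact ((integrableOn_pow_mul_log_sq _).mul_prod (integrableOn_pow_mul_log_sq _)).const_mul _
  have hF (u : ℕ) : ∫ p in Set.Ioo (0 : ℝ) 1 ×ˢ Set.Ioo (0 : ℝ) 1, F u p =
      -4 * (1 / (((u : ℝ) + 1) * (2 * ((m + 1 : ℕ) : ℝ) + 1 + ((u : ℝ) + 1)) ^ 6)) := by
    rw [integral_const_mul, Measure.volume_eq_prod, setIntegral_prod_mul (g u) (g u),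
      integral_pow_mul_log_sq]
    push_cast
    have : (2 * (m : ℝ) + u + 1 + 3) = 2 * ((m : ℝ) + 1) + 1 + (u + 1) := by ring
    rw [this]
    field_simp
    ring
  have hF_norm (u : ℕ) : ∫ p in Set.Ioo (0 : ℝ) 1 ×ˢ Set.Ioo (0 : ℝ) 1, ‖F u p‖ =
      4 * (1 / (((u : ℝ) + 1) * (2 * ((m + 1 : ℕ) : ℝ) + 1 + ((u : ℝ) + 1)) ^ 6)) := by
    rw [← neg_inj, ← neg_mul, ← hF u, ← integral_neg]
    refine setIntegral_congr_fun (measurableSet_Ioo.prod measurableSet_Ioo) ?_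
    rintro ⟨x, y⟩ ⟨⟨hx, -⟩, hy, -⟩
    have : F u (x, y) ≤ 0 := by
      have hx' : 0 < x := hx
      have hy' : 0 < y := hy
      simp only [F, g, neg_mul, neg_nonpos]
      positivity
    simp [abs_of_nonpos this]
  have hsum : Summable fun u : ℕ =>
      1 / (((u : ℝ) + 1) * (2 * ((m + 1 : ℕ) : ℝ) + 1 + ((u : ℝ) + 1)) ^ 6) := by
    have h2 : Summable fun u : ℕ => 1 / ((u : ℝ) + 1) ^ 2 := by
      simpa using (summable_nat_add_iff 1).2 (Real.summable_one_div_nat_pow.2 one_lt_two)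
    refine h2.of_nonneg_of_le (fun u => by positivity) fun u => ?_
    refine one_div_le_one_div_of_le (by positivity) ?_
    rw [sq]
    refine mul_le_mul_of_nonneg_left ?_ (by positivity)
    have hle : (u : ℝ) + 1 ≤ 2 * ((m + 1 : ℕ) : ℝ) + 1 + ((u : ℝ) + 1) := by
      have : (0 : ℝ) ≤ ((m + 1 : ℕ) : ℝ) := by positivity
      linarith
    refine hle.trans (le_self_pow₀ ?_ (by norm_num))
    have : (0 : ℝ) ≤ (u : ℝ) := by positivity
    linarith
  have key := integral_tsum_of_summable_integral_norm hF_int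
    (by simpa only [hF_norm] using hsum.mul_left 4)
  simp only [hF] at key
  rw [← tsum_mul_left, key]
  refine setIntegral_congr_fun (measurableSet_Ioo.prod measurableSet_Ioo) ?_
  rintro ⟨x, y⟩ ⟨⟨hx0, hx1⟩, hy0, hy1⟩
  simp only at hx0 hx1 hy0 hy1
  have hxy : |x * y| < 1 := by
    rw [abs_of_pos (by positivity)]
    nlinarith
  have hs := (Real.hasSum_pow_div_log_of_abs_lt_one hxy).mul_left
    (-((x * y) ^ (2 * m + 2) * Real.log x ^ 2 * Real.log y ^ 2))
  have hFs : (fun u => F u (x, y)) = fun u : ℕ =>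
      -((x * y) ^ (2 * m + 2) * Real.log x ^ 2 * Real.log y ^ 2) *
        ((x * y) ^ (u + 1) / ((u : ℝ) + 1)) := by
    funext u
    simp only [F, g]
    ring
  simp only
  rw [hFs, hs.tsum_eq]
  field_simp
  ring
end
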